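/- The following three statements are equivalent: (i) for every noetherian local ring (R,m), every i ≥ 1 and all x_1,…,x_i ∈ R, one has Ass_R(D(H^i_{(x_1,…,x_i)R}(R))) = { p ∈ Spec(R) : H^i_{(x_1,…,x_i)R}(R/p) ≠ 0 }; (ii) for every noetherian local ring (R,m), every i ≥ 1 and all x_1,…,x_i ∈ R, the set Y := Ass_R(D(H^i_{(x_1,…,x_i)R}(R))) is stable under generalization, i.e. whenever p ⊆ q are prime ideals of R with q ∈ Y, then p ∈ Y; (iii) for every noetherian local domain (R,m), every i ≥ 1 and all x_1,…,x_i ∈ R, if H^i_{(x_1,…,x_i)R}(R) ≠ 0 then the zero ideal of R belongs to Ass_R(D(H^i_{(x_1,…,x_i)R}(R))). -/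

import Mathlib

open IsLocalRing

universe u

/-- The underlying `R`-module of the `i`-th local cohomology of the `R`-module `M`
with support in the ideal `I`. -/
noncomputable abbrev LocalCohomologyModule {R : Type u} [CommRing R] (I : Ideal R) (i : ℕ)
    (M : Type u) [AddCommGroup M] [Module R M] : ModuleCat R :=
  (localCohomology I i).obj (ModuleCat.of R M)

/-- `E` is an injective hull of the residue field of the local ring `R`. -/
def IsInjectiveHullOfResidueField (R : Type u) [CommRing R] [IsLocalRing R]
    (E : Type u) [AddCommGroup E] [Module R E] : Prop :=
  Module.Injective R E ∧
    ∃ f : ResidueField R →ₗ[R] E, Function.Injective f ∧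
      ∀ N : Submodule R E, N ≠ ⊥ → N ⊓ LinearMap.range f ≠ ⊥

/-- Conjecture (*): for every noetherian local ring `(R,m)`, every `i ≥ 1` and all
`x_1,…,x_i ∈ R`, one has
`Ass_R(D(H^i_{(x_1,…,x_i)R}(R))) = { p ∈ Spec R | H^i_{(x_1,…,x_i)R}(R/p) ≠ 0 }`. -/
def ConjectureStar : Prop :=
  ∀ (R : Type u) [CommRing R] [IsLocalRing R] [IsNoetherianRing R]
    (i : ℕ), 1 ≤ i → ∀ (x : Fin i → R)
    (E : Type u) [AddCommGroup E] [Module R E], IsInjectiveHullOfResidueField R E →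
      associatedPrimes R (LocalCohomologyModule (Ideal.span (Set.range x)) i R →ₗ[R] E) =
        { p : Ideal R | p.IsPrime ∧
          Nontrivial (LocalCohomologyModule (Ideal.span (Set.range x)) i (R ⧸ p)) }

/-- Property (O): for every noetherian local ring `(R,m)`, every `i ≥ 1` and all
`x_1,…,x_i ∈ R`, the set `Y = Ass_R(D(H^i_{(x_1,…,x_i)R}(R)))` is stable under
generalization: `p ⊆ q` primes with `q ∈ Y` implies `p ∈ Y`. -/
def OpennessProperty : Prop :=
  ∀ (R : Type u) [CommRing R] [IsLocalRing R] [IsNoetherianRing R]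
    (i : ℕ), 1 ≤ i → ∀ (x : Fin i → R)
    (E : Type u) [AddCommGroup E] [Module R E], IsInjectiveHullOfResidueField R E →
      ∀ p q : Ideal R, p.IsPrime → q.IsPrime → p ≤ q →
        q ∈ associatedPrimes R
            (LocalCohomologyModule (Ideal.span (Set.range x)) i R →ₗ[R] E) →
        p ∈ associatedPrimes R
            (LocalCohomologyModule (Ideal.span (Set.range x)) i R →ₗ[R] E)

/-- For every noetherian local domain `(R,m)`, every `i ≥ 1` and all `x_1,…,x_i ∈ R`,
if `H^i_{(x_1,…,x_i)R}(R) ≠ 0` then `{0} ∈ Ass_R(D(H^i_{(x_1,…,x_i)R}(R)))`. -/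
def ZeroIdealAssociatedForDomains : Prop :=
  ∀ (R : Type u) [CommRing R] [IsLocalRing R] [IsNoetherianRing R] [IsDomain R]
    (i : ℕ), 1 ≤ i → ∀ (x : Fin i → R)
    (E : Type u) [AddCommGroup E] [Module R E], IsInjectiveHullOfResidueField R E →
      Nontrivial (LocalCohomologyModule (Ideal.span (Set.range x)) i R) →
        (⊥ : Ideal R) ∈ associatedPrimes R
          (LocalCohomologyModule (Ideal.span (Set.range x)) i R →ₗ[R] E)

section TorsionSubmodule

variable {R : Type*} [CommRing R] {E E' : Type*} [AddCommGroup E] [Module R E]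
  [AddCommGroup E'] [Module R E']

/-- The submodule of elements killed by some power of the ideal `J`. -/
def idealPowTorsion (J : Ideal R) (E : Type*) [AddCommGroup E] [Module R E] : Submodule R E where
  carrier := {e | ∃ n : ℕ, ∀ a ∈ J ^ n, a • e = 0}
  zero_mem' := ⟨0, fun _ _ => smul_zero _⟩
  add_mem' := by
    rintro e f ⟨n, hn⟩ ⟨m, hm⟩
    refine ⟨n + m, fun a ha => ?_⟩
    rw [smul_add, hn a (Ideal.pow_le_pow_right (by omega) ha),
      hm a (Ideal.pow_le_pow_right (by omega) ha), add_zero]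
  smul_mem' := by
    rintro c e ⟨n, hn⟩
    exact ⟨n, fun a ha => by rw [smul_comm, hn a ha, smul_zero]⟩

/-- The submodule of elements of `A` killed by some power of `x`. -/
def Submodule.powTorsionPart (A : Submodule R E) (x : R) : Submodule R E where
  carrier := {e | e ∈ A ∧ ∃ n : ℕ, x ^ n • e = 0}
  zero_mem' := ⟨A.zero_mem, 0, smul_zero _⟩
  add_mem' := by
    rintro e f ⟨he, n, hn⟩ ⟨hf, m, hm⟩
    refine ⟨A.add_mem he hf, n + m, ?_⟩
    rw [smul_add, pow_add, mul_smul _ _ f, hm, mul_comm, mul_smul, hn, smul_zero, smul_zero,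
      add_zero]
  smul_mem' := by
    rintro c e ⟨he, n, hn⟩
    exact ⟨A.smul_mem c he, n, by rw [smul_comm, hn, smul_zero]⟩

theorem idealPowTorsion_bot : idealPowTorsion (⊥ : Ideal R) E = ⊤ := by
  refine eq_top_iff.mpr fun e _ => ⟨1, fun a ha => ?_⟩
  rw [pow_one, Ideal.mem_bot] at ha
  rw [ha, zero_smul]

theorem idealPowTorsion_span_singleton_sup (x : R) (J : Ideal R) :
    idealPowTorsion (Ideal.span {x} ⊔ J) E = (idealPowTorsion J E).powTorsionPart x := by
  ext e
  constructor
  · rintro ⟨n, hn⟩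
    refine ⟨⟨n, fun a ha => hn a (Ideal.pow_right_mono le_sup_right n ha)⟩, n, hn _ ?_⟩
    exact Ideal.pow_mem_pow (Ideal.mem_sup_left (Ideal.mem_span_singleton_self x)) n
  · rintro ⟨⟨n, hn⟩, m, hm⟩
    refine ⟨m + n, fun a ha => ?_⟩
    have h := Ideal.sup_pow_add_le_pow_sup_pow ha
    rw [Ideal.span_singleton_pow] at h
    obtain ⟨b, hb, c, hc, rfl⟩ := Submodule.mem_sup.mp h
    obtain ⟨b, rfl⟩ := Ideal.mem_span_singleton'.mp hb
    rw [add_smul, hn c hc, mul_smul, hm, smul_zero, add_zero]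

theorem map_mem_idealPowTorsion (J : Ideal R) (d : E →ₗ[R] E') {e : E}
    (he : e ∈ idealPowTorsion J E) : d e ∈ idealPowTorsion J E' := by
  obtain ⟨n, hn⟩ := he
  exact ⟨n, fun a ha => by rw [← map_smul, hn a ha, map_zero]⟩

/-- Every element of `A` is divisible by every power of `x`, up to `x`-power torsion. -/
def Submodule.DivisibleModTorsion (A : Submodule R E) (x : R) : Prop :=
  ∀ a ∈ A, ∀ k : ℕ, ∃ b ∈ A, ∃ l : ℕ, x ^ (l + k) • b = x ^ l • a

theorem Submodule.DivisibleModTorsion.map {A : Submodule R E} {x : R}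
    (h : A.DivisibleModTorsion x) (d : E →ₗ[R] E') : (A.map d).DivisibleModTorsion x := by
  rintro _ ⟨a, ha, rfl⟩ k
  obtain ⟨b, hb, l, hl⟩ := h a ha k
  exact ⟨d b, ⟨b, hb, rfl⟩, l, by rw [← map_smul, hl, map_smul]⟩

theorem Submodule.divisibleModTorsion_bot (x : R) :
    (⊥ : Submodule R E).DivisibleModTorsion x := by
  intro a ha k
  exact ⟨a, ha, 0, by rw [(Submodule.mem_bot R).mp ha, smul_zero, smul_zero]⟩

theorem exists_pow_mul_eq_zero_stable [IsNoetherianRing R] (x : R) :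
    ∃ t : ℕ, ∀ k a, x ^ (t + k) * a = 0 → x ^ t * a = 0 := by
  obtain ⟨t, ht⟩ := monotone_stabilizes_iff_noetherian.mpr ‹IsNoetherianRing R›
    ⟨fun n => LinearMap.ker (LinearMap.mulLeft R (x ^ n)), monotone_nat_of_le_succ fun n a ha => by
      simp only [LinearMap.mem_ker, LinearMap.mulLeft_apply] at ha ⊢
      rw [pow_succ, mul_assoc, mul_left_comm, ha, mul_zero]⟩
  refine ⟨t, fun k a ha => ?_⟩
  have h := ht (t + k) (Nat.le_add_right t k)
  have : a ∈ LinearMap.ker (LinearMap.mulLeft R (x ^ (t + k))) := by simpa using ha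
  simp only [OrderHom.coe_mk] at h
  rw [← h] at this
  simpa using this

end TorsionSubmodule

theorem Module.Injective.divisibleModTorsion_idealPowTorsion {R E : Type u} [CommRing R]
    [IsNoetherianRing R] [AddCommGroup E] [Module R E] [hE : Module.Injective R E]
    (J : Ideal R) (x : R) : (idealPowTorsion J E).DivisibleModTorsion x := by
  rintro e ⟨n, hn⟩ k
  obtain ⟨t, ht⟩ := exists_pow_mul_eq_zero_stable x
  obtain ⟨c, hc⟩ := Ideal.exists_pow_inf_eq_pow_smul J
    (Ideal.span {x ^ (t + k)} : Submodule R R)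
  let μ : R →ₗ[R] R ⧸ J ^ (n + c) := (Submodule.mkQ _).comp (LinearMap.mulLeft R (x ^ (t + k)))
  let g : R →ₗ[R] E := (LinearMap.toSpanSingleton R E e).comp (LinearMap.mulLeft R (x ^ t))
  have hker : LinearMap.ker μ ≤ LinearMap.ker g := by
    intro a ha
    have ha' : x ^ (t + k) * a ∈ J ^ (n + c) := by
      exact (Submodule.Quotient.mk_eq_zero _).mp (LinearMap.mem_ker.mp ha)
    have hmem : x ^ (t + k) * a ∈ (J ^ (n + c) • ⊤ ⊓ Ideal.span {x ^ (t + k)} : Submodule R R) :=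
      ⟨by simpa using ha', Ideal.mul_mem_right _ _ (Ideal.mem_span_singleton_self _)⟩
    rw [hc _ (Nat.le_add_left c n), Nat.add_sub_cancel] at hmem
    have hmem' : x ^ (t + k) * a ∈ J ^ n * Ideal.span {x ^ (t + k)} :=
      Submodule.smul_mono le_rfl inf_le_right hmem
    obtain ⟨b, hb, hab⟩ := Ideal.mem_mul_span_singleton.mp hmem'
    have h0 : x ^ t * (a - b) = 0 := ht k _ (by rw [mul_sub, ← hab, mul_comm b, sub_self])
    have h1 : x ^ t * a = x ^ t * b := by rwa [mul_sub, sub_eq_zero] at h0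
    simp only [g, LinearMap.mem_ker, LinearMap.comp_apply, LinearMap.mulLeft_apply,
      LinearMap.toSpanSingleton_apply, h1, mul_smul, hn b hb, smul_zero]
  obtain ⟨h, hh⟩ := hE.out ((LinearMap.ker μ).liftQ μ le_rfl)
    (LinearMap.ker_eq_bot.mp (Submodule.ker_liftQ_eq_bot' _ _ rfl))
    ((LinearMap.ker μ).liftQ g hker)
  have h1 := hh (Submodule.Quotient.mk 1)
  refine ⟨h (Submodule.Quotient.mk 1), ⟨n + c, fun a ha => ?_⟩, t, ?_⟩
  · rw [← map_smul, ← Submodule.Quotient.mk_smul, smul_eq_mul, mul_one,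
      (Submodule.Quotient.mk_eq_zero _).mpr ha, map_zero]
  · rw [Submodule.liftQ_apply, Submodule.liftQ_apply] at h1
    have h2 : μ 1 = x ^ (t + k) • Submodule.Quotient.mk 1 := rfl
    rw [h2, map_smul] at h1
    rw [h1]
    simp only [g, LinearMap.comp_apply, LinearMap.mulLeft_apply,
      LinearMap.toSpanSingleton_apply, mul_one]


section AwayCokernel

variable {R : Type u} [CommRing R]

/-- The cokernel `N_x / N` of the localization map away from `x`. -/
abbrev AwayCokernel (x : R) (N : Type u) [AddCommGroup N] [Module R N] : Type u :=
  LocalizedModule (Submonoid.powers x) N ⧸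
    LinearMap.range (LocalizedModule.mkLinearMap (Submonoid.powers x) N)

variable {N N' V : Type u} [AddCommGroup N] [Module R N] [AddCommGroup N'] [Module R N']
  [AddCommGroup V] [Module R V]

/-- The cokernel of any localization map away from `x` is `AwayCokernel`. -/
noncomputable def quotientRangeEquivAwayCokernel (x : R) (f : N →ₗ[R] V)
    [IsLocalizedModule (Submonoid.powers x) f] :
    (V ⧸ LinearMap.range f) ≃ₗ[R] AwayCokernel x N :=
  Submodule.Quotient.equiv _ _
    (IsLocalizedModule.linearEquiv (Submonoid.powers x) f
      (LocalizedModule.mkLinearMap (Submonoid.powers x) N)) (by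
    rw [← LinearMap.range_comp]
    congr 1
    ext n
    simp [IsLocalizedModule.linearEquiv_apply])

/-- `AwayCokernel` is invariant under isomorphism. -/
noncomputable def awayCokernelCongr (x : R) (e : N ≃ₗ[R] N') :
    AwayCokernel x N ≃ₗ[R] AwayCokernel x N' :=
  Submodule.Quotient.equiv _ _
    (IsLocalizedModule.linearEquiv (Submonoid.powers x)
      (LocalizedModule.mkLinearMap (Submonoid.powers x) N)
      (LocalizedModule.mkLinearMap (Submonoid.powers x) N' ∘ₗ e.toLinearMap)) (by
    rw [← LinearMap.range_comp]
    trans LinearMap.range (LocalizedModule.mkLinearMap (Submonoid.powers x) N' ∘ₗ e.toLinearMap)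
    · congr 1
      ext n
      simp only [LinearMap.comp_apply, LinearEquiv.coe_coe, IsLocalizedModule.linearEquiv_apply]
    · exact LinearMap.range_comp_of_range_eq_top _ (LinearEquiv.range e))

/-- The iteration of `N ↦ N_x / N` along a list of elements. -/
noncomputable def iteratedAwayCokernel (N : ModuleCat.{u} R) : List R → ModuleCat.{u} R
  | [] => N
  | x :: l => ModuleCat.of R (AwayCokernel x (iteratedAwayCokernel N l))

theorem isLocalizedModule_powers_of_bijective (x : R) (f : N →ₗ[R] V)
    (hx : Function.Bijective fun v : V => x • v)
    (hsurj : ∀ v, ∃ (k : ℕ) (n : N), x ^ k • v = f n)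
    (hker : ∀ n, f n = 0 → ∃ k : ℕ, x ^ k • n = 0) :
    IsLocalizedModule (Submonoid.powers x) f where
  map_units := by
    have h : IsUnit (algebraMap R (Module.End R V) x) := (Module.End.isUnit_iff _).mpr hx
    rintro ⟨_, k, rfl⟩
    simpa using h.pow k
  surj v := by
    obtain ⟨k, n, h⟩ := hsurj v
    exact ⟨(n, ⟨x ^ k, k, rfl⟩), h⟩
  exists_of_eq := by
    intro n m h
    obtain ⟨k, hk⟩ := hker (n - m) (by rw [map_sub, h, sub_self])
    refine ⟨⟨x ^ k, k, rfl⟩, show x ^ k • n = x ^ k • m from ?_⟩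
    rw [← sub_eq_zero, ← smul_sub, hk]

/-- Two quotients of the same module by the same kernel are isomorphic. -/
noncomputable def LinearMap.equivOfSurjectiveOfKerEq {U : Type*} [AddCommGroup U] [Module R U]
    (f : U →ₗ[R] N) (g : U →ₗ[R] V)
    (hf : Function.Surjective f) (hg : Function.Surjective g)
    (h : LinearMap.ker f = LinearMap.ker g) : N ≃ₗ[R] V :=
  (f.quotKerEquivOfSurjective hf).symm.trans
    ((Submodule.quotEquivOfEq _ _ h).trans (g.quotKerEquivOfSurjective hg))

variable {E E' : Type u} [AddCommGroup E] [Module R E] [AddCommGroup E'] [Module R E']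

/-- The connecting isomorphism for the torsion subcomplex of an `x`-divisible complex. -/
theorem nonempty_quotient_map_powTorsionPart_equiv (x : R) (d : E →ₗ[R] E')
    (A B : Submodule R E) (Z' : Submodule R E') (hB : B ≤ A ⊓ LinearMap.ker d)
    (hA_div : A.DivisibleModTorsion x) (hB_div : B.DivisibleModTorsion x)
    (hZ' : ∀ y, y ∈ Z' ↔ y ∈ A.map d ∧ ∃ k : ℕ, x ^ k • y = 0) :
    Nonempty ((Z' ⧸ ((A.powTorsionPart x).map d).submoduleOf Z') ≃ₗ[R]
      AwayCokernel x (↥(A ⊓ LinearMap.ker d) ⧸ B.submoduleOf (A ⊓ LinearMap.ker d))) := by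
  have hmap : ∀ k : ℕ, ∀ e, x ^ k • d e = 0 ↔ d (x ^ k • e) = 0 := fun k e => by rw [map_smul]
  let T := A.powTorsionPart x
  let Z := A ⊓ LinearMap.ker d
  let U : Submodule R E := A ⊓ Submodule.comap d ((⊤ : Submodule R E').powTorsionPart x)
  have hU : ∀ e, e ∈ U ↔ e ∈ A ∧ ∃ k : ℕ, x ^ k • d e = 0 := fun e =>
    ⟨fun h => ⟨h.1, h.2.2⟩, fun h => ⟨h.1, trivial, h.2⟩⟩
  have hZU : Z ≤ U := fun e he => (hU e).mpr ⟨he.1, 0, by rw [LinearMap.mem_ker.mp he.2, smul_zero]⟩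
  have hTU : T ≤ U := fun e he => (hU e).mpr ⟨he.1, he.2.imp fun k hk => by
    rw [hmap, hk, map_zero]⟩
  let W := U ⧸ (B ⊔ T).submoduleOf U
  let f : (Z ⧸ B.submoduleOf Z) →ₗ[R] W :=
    Submodule.mapQ _ _ (Submodule.inclusion hZU) fun e he => Submodule.mem_sup_left he
  have hf : IsLocalizedModule (Submonoid.powers x) f := by
    refine isLocalizedModule_powers_of_bijective x f ⟨?_, ?_⟩ ?_ ?_
    · refine (injective_iff_map_eq_zero (LinearMap.lsmul R W x)).mpr fun w hw => ?_
      obtain ⟨u, rfl⟩ := Submodule.Quotient.mk_surjective _ w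
      have h1 : x • (u : E) ∈ B ⊔ T :=
        (Submodule.Quotient.mk_eq_zero ((B ⊔ T).submoduleOf U)).mp hw
      obtain ⟨b, hb, t, ht, hbt⟩ := Submodule.mem_sup.mp h1
      obtain ⟨c, hc, l, hl⟩ := hB_div b hb 1
      obtain ⟨n, hn⟩ := ht.2
      refine (Submodule.Quotient.mk_eq_zero _).mpr (show (u : E) ∈ B ⊔ T from ?_)
      refine Submodule.mem_sup.mpr ⟨c, hc, u - c,
        ⟨A.sub_mem ((hU _).mp u.2).1 (hB hc).1, n + (l + 1), ?_⟩, add_sub_cancel _ _⟩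
      have h2 : x ^ l • x • (u : E) = x ^ (l + 1) • c + x ^ l • t := by
        rw [← hbt, smul_add, hl]
      rw [pow_add, mul_smul, smul_sub, pow_succ x l, mul_smul, h2, ← pow_succ,
        add_sub_cancel_left, smul_comm, hn, smul_zero]
    · intro w
      obtain ⟨u, rfl⟩ := Submodule.Quotient.mk_surjective _ w
      obtain ⟨huA, k, hk⟩ := (hU _).mp u.2
      obtain ⟨c, hc, l, hl⟩ := hA_div u huA 1
      have hcU : c ∈ U := (hU c).mpr ⟨hc, k + (l + 1), by
        rw [pow_add, mul_smul, ← map_smul, hl, map_smul, smul_comm, hk, smul_zero]⟩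
      refine ⟨Submodule.Quotient.mk ⟨c, hcU⟩, ?_⟩
      change Submodule.Quotient.mk (x • (⟨c, hcU⟩ : U)) = _
      refine (Submodule.Quotient.eq _).mpr (show x • c - (u : E) ∈ B ⊔ T from ?_)
      refine Submodule.mem_sup_right ⟨A.sub_mem (A.smul_mem _ hc) huA, l, ?_⟩
      rw [smul_sub, ← mul_smul, ← pow_succ, hl, sub_self]
    · intro w
      obtain ⟨u, rfl⟩ := Submodule.Quotient.mk_surjective _ w
      obtain ⟨huA, k, hk⟩ := (hU _).mp u.2
      exact ⟨k, Submodule.Quotient.mk ⟨x ^ k • (u : E), A.smul_mem _ huA,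
        LinearMap.mem_ker.mpr (by rw [map_smul, hk])⟩, rfl⟩
    · intro n hn
      obtain ⟨z, rfl⟩ := Submodule.Quotient.mk_surjective _ n
      have h1 : (z : E) ∈ B ⊔ T :=
        (Submodule.Quotient.mk_eq_zero ((B ⊔ T).submoduleOf U)).mp hn
      obtain ⟨b, hb, t, ht, hbt⟩ := Submodule.mem_sup.mp h1
      obtain ⟨k, hk⟩ := ht.2
      refine ⟨k, (Submodule.Quotient.mk_eq_zero _).mpr (show x ^ k • (z : E) ∈ B from ?_)⟩
      rw [← hbt, smul_add, hk, add_zero]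
      exact B.smul_mem _ hb
  let g : U →ₗ[R] Z' ⧸ (T.map d).submoduleOf Z' :=
    (Submodule.mkQ _).comp ((d.comp U.subtype).codRestrict Z' fun u =>
      (hZ' _).mpr ⟨⟨u, ((hU _).mp u.2).1, rfl⟩, ((hU _).mp u.2).2⟩)
  let p : U →ₗ[R] W ⧸ LinearMap.range f := (Submodule.mkQ _).comp (Submodule.mkQ _)
  refine ⟨(LinearMap.equivOfSurjectiveOfKerEq g p ?_ ?_ ?_).trans
    (quotientRangeEquivAwayCokernel x f)⟩
  · intro y
    obtain ⟨y, rfl⟩ := Submodule.Quotient.mk_surjective _ y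
    obtain ⟨⟨a, ha, hay⟩, k, hk⟩ := (hZ' _).mp y.2
    refine ⟨⟨a, (hU a).mpr ⟨ha, k, by rw [hay, hk]⟩⟩, ?_⟩
    exact congrArg Submodule.Quotient.mk (Subtype.ext hay)
  · exact (Submodule.mkQ_surjective _).comp (Submodule.mkQ_surjective _)
  · ext u
    trans ∃ z ∈ Z, ∃ t ∈ T, z + t = (u : E)
    · constructor
      · intro h
        have h1 : d u ∈ T.map d :=
          (Submodule.Quotient.mk_eq_zero ((T.map d).submoduleOf Z')).mp (LinearMap.mem_ker.mp h)
        obtain ⟨t, ht, htu⟩ := h1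
        exact ⟨u - t, ⟨A.sub_mem ((hU _).mp u.2).1 ht.1,
          LinearMap.mem_ker.mpr (by rw [map_sub, htu, sub_self])⟩, t, ht, sub_add_cancel _ _⟩
      · rintro ⟨z, hz, t, ht, hzt⟩
        refine LinearMap.mem_ker.mpr ((Submodule.Quotient.mk_eq_zero _).mpr
          (show d u ∈ T.map d from ⟨t, ht, ?_⟩))
        rw [← hzt, map_add, LinearMap.mem_ker.mp hz.2, zero_add]
    · constructor
      · rintro ⟨z, hz, t, ht, hzt⟩
        refine LinearMap.mem_ker.mpr ((Submodule.Quotient.mk_eq_zero _).mpr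
          ⟨Submodule.Quotient.mk ⟨z, hz⟩, ?_⟩)
        refine (Submodule.Quotient.eq _).mpr (show z - (u : E) ∈ B ⊔ T from ?_)
        rw [← hzt, sub_add_cancel_left]
        exact Submodule.mem_sup_right (T.neg_mem ht)
      · intro h
        obtain ⟨n, hn⟩ := (Submodule.Quotient.mk_eq_zero _).mp (LinearMap.mem_ker.mp h)
        obtain ⟨z, rfl⟩ := Submodule.Quotient.mk_surjective _ n
        have h1 : (z : E) - (u : E) ∈ B ⊔ T :=
          (Submodule.Quotient.eq ((B ⊔ T).submoduleOf U)).mp hn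
        obtain ⟨b, hb, t, ht, hbt⟩ := Submodule.mem_sup.mp h1
        refine ⟨z - b, Z.sub_mem z.2 (hB hb), -t, T.neg_mem ht, ?_⟩
        have h2 : (u : E) = z - (b + t) := by rw [hbt]; abel
        rw [h2]
        abel

end AwayCokernel

section TorsionCohomology

variable {R : Type u} [CommRing R] (E : ℕ → Type u) [∀ j, AddCommGroup (E j)]
  [∀ j, Module R (E j)] (d : ∀ j, E j →ₗ[R] E (j + 1))

/-- The degree `j` cocycles of the subcomplex of `J`-power torsion elements. -/
def torsionCocycles (J : Ideal R) (j : ℕ) : Submodule R (E j) :=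
  idealPowTorsion J (E j) ⊓ LinearMap.ker (d j)

/-- The degree `j` coboundaries of the subcomplex of `J`-power torsion elements. -/
def torsionCoboundaries (J : Ideal R) : ∀ j, Submodule R (E j)
  | 0 => ⊥
  | j + 1 => (idealPowTorsion J (E j)).map (d j)

/-- The degree `j` cohomology of the subcomplex of `J`-power torsion elements. -/
abbrev torsionCohomology (J : Ideal R) (j : ℕ) : Type u :=
  torsionCocycles E d J j ⧸ (torsionCoboundaries E d J j).submoduleOf (torsionCocycles E d J j)

variable {E d}

theorem torsionCoboundaries_le_torsionCocycles
    (hd : ∀ j, LinearMap.range (d j) = LinearMap.ker (d (j + 1))) (J : Ideal R) (j : ℕ) :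
    torsionCoboundaries E d J j ≤ torsionCocycles E d J j := by
  cases j with
  | zero => exact bot_le
  | succ j =>
    rintro _ ⟨a, ha, rfl⟩
    exact ⟨map_mem_idealPowTorsion J _ ha, (hd j).le ⟨a, rfl⟩⟩

theorem torsionCocycles_le_torsionCoboundaries [IsNoetherianRing R]
    [∀ j, Module.Injective R (E j)]
    (hd : ∀ j, LinearMap.range (d j) = LinearMap.ker (d (j + 1))) (l : List R) (j : ℕ)
    (hj : l.length ≤ j) :
    torsionCocycles E d (Ideal.ofList l) (j + 1) ≤
      torsionCoboundaries E d (Ideal.ofList l) (j + 1) := by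
  induction l generalizing j with
  | nil =>
    rintro z ⟨-, hz⟩
    obtain ⟨a, rfl⟩ := (hd j).ge hz
    refine ⟨a, ?_, rfl⟩
    rw [Ideal.ofList_nil, idealPowTorsion_bot]
    trivial
  | cons x l ih =>
    obtain ⟨j, rfl⟩ : ∃ i, j = i + 1 := Nat.exists_eq_succ_of_ne_zero (by
      rintro rfl
      simp at hj)
    have hj' : l.length ≤ j := by simpa using hj
    rintro z ⟨hzT, hz⟩
    rw [Ideal.ofList_cons, idealPowTorsion_span_singleton_sup] at hzT
    obtain ⟨hzl, k, hk⟩ := hzT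
    obtain ⟨a, ha, rfl⟩ := ih (j + 1) (hj'.trans (Nat.le_succ j)) ⟨hzl, hz⟩
    obtain ⟨c, hc, hca⟩ := ih j hj' (x := x ^ k • a)
      ⟨Submodule.smul_mem _ _ ha, LinearMap.mem_ker.mpr (by rw [map_smul, hk])⟩
    obtain ⟨b, hb, m, hm⟩ :=
      Module.Injective.divisibleModTorsion_idealPowTorsion (Ideal.ofList l) x c hc k
    have hdd : d (j + 1) (d j b) = 0 := (hd j).le ⟨b, rfl⟩
    refine ⟨a - d j b, ?_, by rw [map_sub, hdd, sub_zero]⟩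
    rw [Ideal.ofList_cons, idealPowTorsion_span_singleton_sup]
    refine ⟨Submodule.sub_mem _ ha (map_mem_idealPowTorsion _ _ hb), m + k, ?_⟩
    rw [smul_sub, ← map_smul, hm, pow_add, mul_smul, ← hca, map_smul, sub_self]

/-- The cohomology of the subcomplex of torsion elements of an injective resolution, in degree
the number of generators of the ideal. -/
theorem nonempty_torsionCohomology_equiv_iteratedAwayCokernel [IsNoetherianRing R]
    [∀ j, Module.Injective R (E j)]
    (hd : ∀ j, LinearMap.range (d j) = LinearMap.ker (d (j + 1)))
    (M : ModuleCat.{u} R) (ε : M ≃ₗ[R] LinearMap.ker (d 0)) (l : List R) :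
    Nonempty (torsionCohomology E d (Ideal.ofList l) l.length ≃ₗ[R]
      iteratedAwayCokernel M l) := by
  induction l with
  | nil =>
    have h : torsionCocycles E d (Ideal.ofList []) 0 = LinearMap.ker (d 0) := by
      rw [torsionCocycles, Ideal.ofList_nil, idealPowTorsion_bot, top_inf_eq]
    refine ⟨(Submodule.quotEquivOfEqBot _ ?_).trans ((LinearEquiv.ofEq _ _ h).trans ε.symm)⟩
    exact Submodule.ker_subtype _
  | cons x l ih =>
    obtain ⟨e⟩ := ih
    have h := nonempty_quotient_map_powTorsionPart_equiv x (d l.length)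
      (idealPowTorsion (Ideal.ofList l) _) (torsionCoboundaries E d (Ideal.ofList l) l.length)
      (torsionCocycles E d (Ideal.ofList (x :: l)) (l.length + 1))
      (torsionCoboundaries_le_torsionCocycles hd _ _)
      (Module.Injective.divisibleModTorsion_idealPowTorsion _ _) ?_ ?_
    · rw [← idealPowTorsion_span_singleton_sup, ← Ideal.ofList_cons] at h
      exact h.map fun f => f.trans (awayCokernelCongr x e)
    · cases l.length with
      | zero => exact Submodule.divisibleModTorsion_bot x
      | succ n => exact (Module.Injective.divisibleModTorsion_idealPowTorsion _ _).map _
    · intro y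
      rw [torsionCocycles, Ideal.ofList_cons, idealPowTorsion_span_singleton_sup]
      constructor
      · rintro ⟨⟨hy, hk⟩, hdy⟩
        exact ⟨torsionCocycles_le_torsionCoboundaries hd l _ le_rfl ⟨hy, hdy⟩, hk⟩
      · rintro ⟨⟨a, ha, rfl⟩, hk⟩
        exact ⟨⟨map_mem_idealPowTorsion _ _ ha, hk⟩, (hd _).le ⟨a, rfl⟩⟩

end TorsionCohomology

section OppositeHomology

open CategoryTheory Limits Opposite

variable {R : Type u} [Ring R] (K L : ChainComplex (ModuleCat.{u} R)ᵒᵖ ℕ) (n : ℕ)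

/-- The cocycles of the cochain complex of modules opposite to `K`. -/
abbrev opCocycles : Submodule R (K.X n).unop :=
  LinearMap.ker (K.d (n + 1) n).unop.hom

/-- The map from cocycles to the opposite of the opcycles. -/
noncomputable def opCocyclesToOpcycles : ModuleCat.of R (opCocycles K n) ⟶ (K.opcycles n).unop :=
  (K.descOpcycles (A := op (ModuleCat.of R (opCocycles K n)))
    (ModuleCat.ofHom (opCocycles K n).subtype).op (n + 1) (ChainComplex.prev ℕ n) (by
      apply Quiver.Hom.unop_inj
      ext x
      exact x.2)).unop

theorem pOpcycles_unop_opCocyclesToOpcycles (f : opCocycles K n) :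
    (K.pOpcycles n).unop.hom ((opCocyclesToOpcycles K n).hom f) = f := by
  have h := congrArg (fun g => g.unop.hom f) (K.p_descOpcycles
    (A := op (ModuleCat.of R (opCocycles K n)))
    (ModuleCat.ofHom (opCocycles K n).subtype).op (n + 1) (ChainComplex.prev ℕ n) (by
      apply Quiver.Hom.unop_inj
      ext x
      exact x.2))
  exact h

theorem pOpcycles_unop_injective : Function.Injective (K.pOpcycles n).unop.hom :=
  (ModuleCat.mono_iff_injective _).mp inferInstance

theorem opCocyclesToOpcycles_surjective :
    Function.Surjective (opCocyclesToOpcycles K n).hom := by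
  intro c
  refine ⟨⟨(K.pOpcycles n).unop.hom c, ?_⟩, pOpcycles_unop_injective K n ?_⟩
  · exact congrArg (fun g => g.unop.hom c) (K.d_pOpcycles (n + 1) n)
  · rw [pOpcycles_unop_opCocyclesToOpcycles]

/-- The class of a cocycle. -/
noncomputable def opHomologyMk : opCocycles K n →ₗ[R] (K.homology n).unop :=
  (K.homologyι n).unop.hom.comp (opCocyclesToOpcycles K n).hom

theorem opHomologyMk_surjective : Function.Surjective (opHomologyMk K n) :=
  ((ModuleCat.epi_iff_surjective (K.homologyι n).unop).mp inferInstance).comp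
    (opCocyclesToOpcycles_surjective K n)

theorem opHomologyMk_eq_zero_iff (f : opCocycles K (n + 1)) :
    opHomologyMk K (n + 1) f = 0 ↔ ∃ g, (K.d (n + 1) n).unop.hom g = f := by
  have hex : (ShortComplex.mk _ _ (K.homologyι_comp_fromOpcycles (n + 1) n)).Exact :=
    ShortComplex.exact_of_f_is_kernel _
      (K.homologyIsKernel (n + 1) n (ChainComplex.next_nat_succ n))
  have hd : ∀ g, (K.pOpcycles (n + 1)).unop.hom ((K.fromOpcycles (n + 1) n).unop.hom g) =
      (K.d (n + 1) n).unop.hom g := fun g =>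
    congrArg (fun g' => g'.unop.hom g) (K.p_fromOpcycles (n + 1) n)
  constructor
  · intro h
    obtain ⟨g, hg⟩ := (ShortComplex.moduleCat_exact_iff _).mp hex.unop _ h
    exact ⟨g, (hd g).symm.trans ((congrArg (K.pOpcycles (n + 1)).unop.hom hg).trans
      (pOpcycles_unop_opCocyclesToOpcycles K (n + 1) f))⟩
  · rintro ⟨g, hg⟩
    have : (opCocyclesToOpcycles K (n + 1)).hom f = (K.fromOpcycles (n + 1) n).unop.hom g := by
      apply pOpcycles_unop_injective
      rw [hd, hg, pOpcycles_unop_opCocyclesToOpcycles]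
    rw [opHomologyMk, LinearMap.comp_apply, this]
    exact congrArg (fun g' => g'.unop.hom g) (K.homologyι_comp_fromOpcycles (n + 1) n)

variable {K L}

theorem homologyMap_opHomologyMk (φ : K ⟶ L) (f : opCocycles L n) (f' : opCocycles K n)
    (h : (φ.f n).unop.hom f = f') :
    (HomologicalComplex.homologyMap φ n).unop.hom (opHomologyMk L n f) = opHomologyMk K n f' := by
  have h1 := congrArg (fun g => g.unop.hom ((opCocyclesToOpcycles L n).hom f))
    (HomologicalComplex.homologyι_naturality φ n)
  refine h1.trans ?_
  change (K.homologyι n).unop.hom _ = (K.homologyι n).unop.hom _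
  congr 1
  apply pOpcycles_unop_injective
  rw [pOpcycles_unop_opCocyclesToOpcycles, ← h, ← pOpcycles_unop_opCocyclesToOpcycles L]
  exact congrArg (fun g => g.unop.hom ((opCocyclesToOpcycles L n).hom f))
    (HomologicalComplex.p_opcyclesMap φ n)

end OppositeHomology

section ExtComparison

open CategoryTheory Limits Opposite

variable {R : Type u} [CommRing R] {X X' : ModuleCat.{u} R} (P : ProjectiveResolution X)
  (P' : ProjectiveResolution X') (Y : ModuleCat.{u} R) (n : ℕ)

/-- The cocycles of the complex of morphisms from a projective resolution to `Y`. -/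
def homCocycles : Submodule R (P.complex.X n ⟶ Y) where
  carrier := {f | P.complex.d (n + 1) n ≫ f = 0}
  zero_mem' := comp_zero
  add_mem' {f g} hf hg := by
    change _ ≫ (f + g) = 0
    rw [Preadditive.comp_add, show _ ≫ f = 0 from hf, show _ ≫ g = 0 from hg, add_zero]
  smul_mem' r f hf := by
    change _ ≫ (r • f) = 0
    rw [Linear.comp_smul, show _ ≫ f = 0 from hf, smul_zero]

/-- The complex of morphisms from a projective resolution to `Y`, in the opposite category. -/
noncomputable abbrev homComplexOp : ChainComplex (ModuleCat.{u} R)ᵒᵖ ℕ :=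
  (((linearYoneda R (ModuleCat.{u} R)).obj Y).rightOp.mapHomologicalComplex _).obj P.complex

/-- `Ext R C n` as the homology of the complex of morphisms from a projective resolution. -/
noncomputable def homologyHomComplexOpIso :
    ((homComplexOp P Y).homology n).unop ≅ ((Ext R (ModuleCat.{u} R) n).obj (op X)).obj Y :=
  (P.isoLeftDerivedObj ((linearYoneda R (ModuleCat.{u} R)).obj Y).rightOp n).unop

/-- The class in `Ext R C n` of a cocycle. -/
noncomputable def derivedExtMk :
    homCocycles P Y n →ₗ[R] ((Ext R (ModuleCat.{u} R) n).obj (op X)).obj Y :=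
  (homologyHomComplexOpIso P Y n).hom.hom.comp (opHomologyMk (homComplexOp P Y) n)

theorem derivedExtMk_surjective : Function.Surjective (derivedExtMk P Y n) :=
  ((ModuleCat.epi_iff_surjective (homologyHomComplexOpIso P Y n).hom).mp inferInstance).comp
    (opHomologyMk_surjective (homComplexOp P Y) n)

theorem derivedExtMk_eq_zero_iff (f : homCocycles P Y (n + 1)) :
    derivedExtMk P Y (n + 1) f = 0 ↔
      ∃ g : P.complex.X n ⟶ Y, P.complex.d (n + 1) n ≫ g = f := by
  refine Iff.trans ?_ (opHomologyMk_eq_zero_iff (homComplexOp P Y) n f)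
  exact map_eq_zero_iff (homologyHomComplexOpIso P Y (n + 1)).hom.hom
    ((ModuleCat.mono_iff_injective (homologyHomComplexOpIso P Y (n + 1)).hom).mp inferInstance)

variable {P P' Y n}

theorem map_derivedExtMk {g : X' ⟶ X} (φ : ProjectiveResolution.Hom P' P g)
    (f : homCocycles P Y n) (f' : homCocycles P' Y n)
    (h : φ.hom.f n ≫ (f : P.complex.X n ⟶ Y) = f') :
    (((Ext R (ModuleCat.{u} R) n).map g.op).app Y).hom (derivedExtMk P Y n f) =
      derivedExtMk P' Y n f' := by
  have h1 := ProjectiveResolution.isoLeftDerivedObj_hom_naturality g P' P φ.hom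
    φ.hom_f_zero_comp_π_f_zero ((linearYoneda R (ModuleCat.{u} R)).obj Y).rightOp n
  refine (congrArg (fun m => m.unop.hom (opHomologyMk (homComplexOp P Y) n f)) h1).trans ?_
  refine congrArg (homologyHomComplexOpIso P' Y n).hom.hom ?_
  exact homologyMap_opHomologyMk n
    ((((linearYoneda R (ModuleCat.{u} R)).obj Y).rightOp.mapHomologicalComplex _).map φ.hom) f f' h

end ExtComparison

section ExtLinear

open CategoryTheory Limits Opposite Abelian

variable {R : Type u} [CommRing R] {X X' : ModuleCat.{u} R} (P : ProjectiveResolution X)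
  (P' : ProjectiveResolution X') (Y : ModuleCat.{u} R) (n : ℕ)

/-- The class in `Abelian.Ext` of a cocycle of the complex of morphisms from a projective
resolution. -/
noncomputable def projExtMk : homCocycles P Y n →ₗ[R] Abelian.Ext.{u} X Y n where
  toFun f := P.extMk f.1 (n + 1) rfl f.2
  map_add' f g := (P.add_extMk f.1 g.1 (n + 1) rfl f.2 g.2).symm
  map_smul' r f := by
    rw [RingHom.id_apply, Ext.smul_eq_comp_mk₀]
    refine Eq.trans ?_ (P.extMk_comp_mk₀ f.1 (n + 1) rfl f.2 (r • 𝟙 Y)).symm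
    congr 1

variable {Y n}

theorem exists_linearEquiv_derivedExtMk [NeZero n] :
    ∃ e : ((_root_.Ext R (ModuleCat.{u} R) n).obj (op X)).obj Y ≃ₗ[R] Abelian.Ext.{u} X Y n,
      ∀ f, e (derivedExtMk P Y n f) = projExtMk P Y n f := by
  have hsurj : Function.Surjective (projExtMk P Y n) := fun α => by
    obtain ⟨f, hf, rfl⟩ := P.extMk_surjective α (n + 1) rfl
    exact ⟨⟨f, hf⟩, rfl⟩
  have hker : LinearMap.ker (derivedExtMk P Y n) = LinearMap.ker (projExtMk P Y n) := by
    obtain ⟨m, rfl⟩ := Nat.exists_eq_succ_of_ne_zero (NeZero.ne n)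
    ext f
    rw [LinearMap.mem_ker, LinearMap.mem_ker, derivedExtMk_eq_zero_iff]
    exact (P.extMk_eq_zero_iff f.1 _ rfl f.2 m rfl).symm
  refine ⟨LinearMap.equivOfSurjectiveOfKerEq _ _ (derivedExtMk_surjective P Y n) hsurj hker, ?_⟩
  intro f
  simp [LinearMap.equivOfSurjectiveOfKerEq]

/-- The comparison between the two constructions of `Ext`. -/
noncomputable def extComparison (X Y : ModuleCat.{u} R) (n : ℕ) [NeZero n] :
    ((_root_.Ext R (ModuleCat.{u} R) n).obj (op X)).obj Y ≃ₗ[R] Abelian.Ext.{u} X Y n :=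
  (exists_linearEquiv_derivedExtMk (projectiveResolution X)).choose

theorem extComparison_derivedExtMk (X Y : ModuleCat.{u} R) (n : ℕ) [NeZero n]
    (f : homCocycles (projectiveResolution X) Y n) :
    extComparison X Y n (derivedExtMk (projectiveResolution X) Y n f) =
      projExtMk (projectiveResolution X) Y n f :=
  (exists_linearEquiv_derivedExtMk (projectiveResolution X)).choose_spec f

theorem extComparison_naturality (g : X' ⟶ X) (Y : ModuleCat.{u} R) (n : ℕ) [NeZero n]
    (α : ((_root_.Ext R (ModuleCat.{u} R) n).obj (op X)).obj Y) :
    extComparison X' Y n ((((_root_.Ext R (ModuleCat.{u} R) n).map g.op).app Y).hom α) =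
      (Ext.mk₀ g).comp (extComparison X Y n α) (zero_add n) := by
  obtain ⟨f, rfl⟩ := derivedExtMk_surjective (projectiveResolution X) Y n α
  let φ : ProjectiveResolution.Hom (projectiveResolution X') (projectiveResolution X) g :=
    { hom := ProjectiveResolution.lift g _ _
      hom_f_zero_comp_π_f_zero := ProjectiveResolution.lift_commutes_zero g _ _ }
  let f' : homCocycles (projectiveResolution X') Y n := ⟨φ.hom.f n ≫ f.1, by
    have h := f.2
    change _ ≫ _ ≫ _ = 0
    rw [← φ.hom.comm_assoc, show _ ≫ f.1 = 0 from h, comp_zero]⟩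
  rw [map_derivedExtMk φ f f' rfl, extComparison_derivedExtMk, extComparison_derivedExtMk]
  exact (ProjectiveResolution.mk₀_comp_extMk f.1 (n + 1) rfl f.2 φ).symm

end ExtLinear

section ExtQuotient

open CategoryTheory Limits Opposite Abelian

variable {R : Type u} [CommRing R] {M : ModuleCat.{u} R} (Q : InjectiveResolution M) (n : ℕ)

/-- The cocycles of degree `n` of an injective resolution which are killed by `J`. -/
def killedCocycles (J : Ideal R) : Submodule R (Q.cocomplex.X n) where
  carrier := {e | (∀ a ∈ J, a • e = 0) ∧ (Q.cocomplex.d n (n + 1)).hom e = 0}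
  zero_mem' := ⟨fun _ _ => smul_zero _, map_zero _⟩
  add_mem' {e f} he hf := ⟨fun a ha => by rw [smul_add, he.1 a ha, hf.1 a ha, add_zero], by
    rw [map_add, he.2, hf.2, add_zero]⟩
  smul_mem' r e he := ⟨fun a ha => by rw [smul_comm, he.1 a ha, smul_zero], by
    rw [map_smul, he.2, smul_zero]⟩

/-- The morphism `R ⧸ J ⟶ E` attached to an element killed by `J`. -/
def ofKilled {E : ModuleCat.{u} R} {J : Ideal R} (e : E) (he : ∀ a ∈ J, a • e = 0) :
    ModuleCat.of R (R ⧸ J) ⟶ E :=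
  ModuleCat.ofHom (Submodule.liftQ J (LinearMap.toSpanSingleton R E e) he)

theorem ofKilled_one {E : ModuleCat.{u} R} {J : Ideal R} (e : E) (he : ∀ a ∈ J, a • e = 0) :
    (ofKilled e he).hom (Ideal.Quotient.mk J 1) = e := one_smul R e

theorem quotient_hom_ext {E : ModuleCat.{u} R} {J : Ideal R} {f g : ModuleCat.of R (R ⧸ J) ⟶ E}
    (h : f.hom (Ideal.Quotient.mk J 1) = g.hom (Ideal.Quotient.mk J 1)) : f = g :=
  ModuleCat.hom_ext (Submodule.linearMap_qext _ (LinearMap.ext_ring h))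

theorem smul_quotient_mk_one {J : Ideal R} {a : R} (ha : a ∈ J) :
    a • (Ideal.Quotient.mk J 1) = 0 := by
  rw [← Ideal.Quotient.mk_eq_mk, ← Submodule.Quotient.mk_smul, smul_eq_mul, mul_one]
  exact Ideal.Quotient.eq_zero_iff_mem.mpr ha

theorem ofKilled_comp_d {J : Ideal R} (e : killedCocycles Q n J) :
    ofKilled e.1 e.2.1 ≫ Q.cocomplex.d n (n + 1) = 0 :=
  quotient_hom_ext ((congrArg (Q.cocomplex.d n (n + 1)).hom (ofKilled_one e.1 e.2.1)).trans e.2.2)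

/-- The class in `Abelian.Ext` of a cocycle of an injective resolution killed by `J`. -/
noncomputable def injExtMk (J : Ideal R) :
    killedCocycles Q n J →ₗ[R] Abelian.Ext.{u} (ModuleCat.of R (R ⧸ J)) M n where
  toFun e := Q.extMk (ofKilled e.1 e.2.1) (n + 1) rfl (ofKilled_comp_d Q n e)
  map_add' e f := by
    refine Eq.trans ?_ (Q.add_extMk _ _ (n + 1) rfl _ _).symm
    congr 1
    refine quotient_hom_ext ?_
    rw [ofKilled_one]
    exact (congrArg₂ (· + ·) (ofKilled_one e.1 e.2.1) (ofKilled_one f.1 f.2.1)).symm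
  map_smul' r e := by
    rw [RingHom.id_apply, ← Ext.mk₀_id_comp (Q.extMk (ofKilled e.1 e.2.1) (n + 1) rfl _),
      ← Ext.smul_comp, ← Ext.mk₀_smul]
    refine Eq.trans ?_ (Q.mk₀_comp_extMk (ofKilled e.1 e.2.1) (n + 1) rfl _ (r • 𝟙 _)).symm
    congr 1
    refine quotient_hom_ext ?_
    rw [ofKilled_one, Linear.smul_comp, Category.id_comp]
    exact (congrArg (r • ·) (ofKilled_one e.1 e.2.1)).symm

theorem injExtMk_surjective (J : Ideal R) : Function.Surjective (injExtMk Q n J) := by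
  intro α
  obtain ⟨f, hf, rfl⟩ := Q.extMk_surjective α (n + 1) rfl
  refine ⟨⟨f.hom (Ideal.Quotient.mk J 1), fun a ha => ?_, ?_⟩, ?_⟩
  · rw [← map_smul]
    exact (congrArg f.hom (smul_quotient_mk_one ha)).trans (map_zero _)
  · exact congrArg (fun g => g.hom (Ideal.Quotient.mk J 1)) hf
  · refine (?_ : Q.extMk _ (n + 1) rfl (ofKilled_comp_d Q n _) = _)
    congr 1
    exact quotient_hom_ext (ofKilled_one _ _)

theorem injExtMk_eq_zero_iff (J : Ideal R) (e : killedCocycles Q (n + 1) J) :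
    injExtMk Q (n + 1) J e = 0 ↔
      ∃ f, (∀ a ∈ J, a • f = 0) ∧ (Q.cocomplex.d n (n + 1)).hom f = e := by
  refine (Q.extMk_eq_zero_iff (ofKilled e.1 e.2.1) _ rfl (ofKilled_comp_d Q (n + 1) e) n rfl).trans
    ⟨?_, ?_⟩
  · rintro ⟨g, hg⟩
    refine ⟨g.hom (Ideal.Quotient.mk J 1), fun a ha => ?_, ?_⟩
    · rw [← map_smul]
      exact (congrArg g.hom (smul_quotient_mk_one ha)).trans (map_zero _)
    · exact (congrArg (fun g => g.hom (Ideal.Quotient.mk J 1)) hg).trans (ofKilled_one e.1 e.2.1)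
  · rintro ⟨f, hf, hfe⟩
    refine ⟨ofKilled f hf, quotient_hom_ext ?_⟩
    refine Eq.trans ?_ (hfe.trans (ofKilled_one e.1 e.2.1).symm)
    exact congrArg (Q.cocomplex.d n (n + 1)).hom (ofKilled_one f hf)

theorem mk₀_comp_injExtMk {J J' : Ideal R} (g : ModuleCat.of R (R ⧸ J') ⟶ ModuleCat.of R (R ⧸ J))
    (hg : g.hom (Ideal.Quotient.mk J' 1) = Ideal.Quotient.mk J 1) (e : killedCocycles Q n J)
    (e' : killedCocycles Q n J') (h : (e : Q.cocomplex.X n) = e') :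
    (Ext.mk₀ g).comp (injExtMk Q n J e) (zero_add n) = injExtMk Q n J' e' := by
  refine (Q.mk₀_comp_extMk (ofKilled e.1 e.2.1) (n + 1) rfl (ofKilled_comp_d Q n e) g).trans ?_
  refine (?_ : _ = Q.extMk _ (n + 1) rfl (ofKilled_comp_d Q n e'))
  congr 1
  refine quotient_hom_ext ?_
  rw [ofKilled_one, ← h]
  exact (congrArg (ofKilled e.1 e.2.1).hom hg).trans (ofKilled_one e.1 e.2.1)

end ExtQuotient

section LocalCohomologyTorsion

open CategoryTheory Limits Opposite Abelian

/-- Factor a linear map through a surjective one. -/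
noncomputable def LinearMap.factorOfSurjective {R A B C : Type*} [Ring R] [AddCommGroup A]
    [Module R A] [AddCommGroup B] [Module R B] [AddCommGroup C] [Module R C] (f : A →ₗ[R] B)
    (g : A →ₗ[R] C) (hf : Function.Surjective f) (h : LinearMap.ker f ≤ LinearMap.ker g) :
    B →ₗ[R] C :=
  ((LinearMap.ker f).liftQ g h).comp (f.quotKerEquivOfSurjective hf).symm.toLinearMap

theorem LinearMap.factorOfSurjective_apply {R A B C : Type*} [Ring R] [AddCommGroup A]
    [Module R A] [AddCommGroup B] [Module R B] [AddCommGroup C] [Module R C] (f : A →ₗ[R] B)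
    (g : A →ₗ[R] C) (hf : Function.Surjective f) (h : LinearMap.ker f ≤ LinearMap.ker g) (a : A) :
    f.factorOfSurjective g hf h (f a) = g a := by
  simp [LinearMap.factorOfSurjective]

variable {R : Type u} [CommRing R] {M : ModuleCat.{u} R} (Q : InjectiveResolution M) (n : ℕ)

/-- The class in the derived functor `Ext` of a cocycle of an injective resolution killed
by `J`. -/
noncomputable def derivedExtOfKilled (J : Ideal R) : killedCocycles Q (n + 1) J →ₗ[R]
    ((_root_.Ext R (ModuleCat.{u} R) (n + 1)).obj (op (ModuleCat.of R (R ⧸ J)))).obj M :=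
  (extComparison (ModuleCat.of R (R ⧸ J)) M (n + 1)).symm.toLinearMap.comp (injExtMk Q (n + 1) J)

theorem derivedExtOfKilled_surjective (J : Ideal R) :
    Function.Surjective (derivedExtOfKilled Q n J) :=
  (extComparison (ModuleCat.of R (R ⧸ J)) M (n + 1)).symm.surjective.comp
    (injExtMk_surjective Q (n + 1) J)

theorem derivedExtOfKilled_eq_zero_iff (J : Ideal R) (e : killedCocycles Q (n + 1) J) :
    derivedExtOfKilled Q n J e = 0 ↔
      ∃ f, (∀ a ∈ J, a • f = 0) ∧ (Q.cocomplex.d n (n + 1)).hom f = e := by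
  rw [← injExtMk_eq_zero_iff]
  exact (extComparison (ModuleCat.of R (R ⧸ J)) M (n + 1)).symm.map_eq_zero_iff

theorem map_derivedExtOfKilled {J J' : Ideal R}
    (g : ModuleCat.of R (R ⧸ J') ⟶ ModuleCat.of R (R ⧸ J))
    (hg : g.hom (Ideal.Quotient.mk J' 1) = Ideal.Quotient.mk J 1)
    (e : killedCocycles Q (n + 1) J) (e' : killedCocycles Q (n + 1) J')
    (h : (e : Q.cocomplex.X (n + 1)) = e') :
    (((_root_.Ext R (ModuleCat.{u} R) (n + 1)).map g.op).app M).hom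
      (derivedExtOfKilled Q n J e) = derivedExtOfKilled Q n J' e' := by
  apply (extComparison (ModuleCat.of R (R ⧸ J')) M (n + 1)).injective
  rw [extComparison_naturality]
  refine Eq.trans ?_ ((mk₀_comp_injExtMk Q (n + 1) g hg e e' h).trans
    ((extComparison (ModuleCat.of R (R ⧸ J')) M (n + 1)).apply_symm_apply _).symm)
  exact congrArg (fun α => (Ext.mk₀ g).comp α (zero_add (n + 1)))
    ((extComparison (ModuleCat.of R (R ⧸ J)) M (n + 1)).apply_symm_apply _)

/-- The cohomology of the `J`-power torsion subcomplex of an injective resolution. -/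
abbrev resolutionTorsionCohomology (J : Ideal R) (j : ℕ) : Type u :=
  torsionCohomology (fun j => Q.cocomplex.X j) (fun j => (Q.cocomplex.d j (j + 1)).hom) J j

/-- The class of a cocycle killed by a power of `J`. -/
noncomputable def killedCocyclesToTorsionCohomology (J : Ideal R) (k : ℕ) :
    killedCocycles Q (n + 1) (J ^ k) →ₗ[R] resolutionTorsionCohomology Q J (n + 1) :=
  (Submodule.mkQ _).comp (Submodule.inclusion fun _ he => ⟨⟨k, he.1⟩, he.2⟩)

theorem killedCocyclesToTorsionCohomology_eq_zero_iff (J : Ideal R) (k : ℕ)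
    (e : killedCocycles Q (n + 1) (J ^ k)) :
    killedCocyclesToTorsionCohomology Q n J k e = 0 ↔
      ∃ f ∈ idealPowTorsion J (Q.cocomplex.X n), (Q.cocomplex.d n (n + 1)).hom f = e :=
  Submodule.Quotient.mk_eq_zero ((torsionCoboundaries (fun j => Q.cocomplex.X j)
    (fun j => (Q.cocomplex.d j (j + 1)).hom) J (n + 1)).submoduleOf _)

/-- The map from `Ext (R ⧸ J ^ k) M` to the cohomology of the torsion subcomplex. -/
noncomputable def derivedExtToTorsionCohomology (J : Ideal R) (k : ℕ) :
    ((_root_.Ext R (ModuleCat.{u} R) (n + 1)).obj (op (ModuleCat.of R (R ⧸ J ^ k)))).obj M →ₗ[R]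
      resolutionTorsionCohomology Q J (n + 1) :=
  (derivedExtOfKilled Q n (J ^ k)).factorOfSurjective (killedCocyclesToTorsionCohomology Q n J k)
    (derivedExtOfKilled_surjective Q n (J ^ k)) (by
      intro e he
      obtain ⟨f, hf, hfe⟩ := (derivedExtOfKilled_eq_zero_iff Q n _ e).mp he
      exact (killedCocyclesToTorsionCohomology_eq_zero_iff Q n J k e).mpr ⟨f, ⟨k, hf⟩, hfe⟩)

theorem derivedExtToTorsionCohomology_derivedExtOfKilled (J : Ideal R) (k : ℕ)
    (e : killedCocycles Q (n + 1) (J ^ k)) :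
    derivedExtToTorsionCohomology Q n J k (derivedExtOfKilled Q n (J ^ k) e) =
      killedCocyclesToTorsionCohomology Q n J k e :=
  LinearMap.factorOfSurjective_apply _ _ _ _ _

/-- The system of modules `Ext (R ⧸ J ^ k) M` whose colimit is local cohomology. -/
noncomputable abbrev extPowersDiagram (M : ModuleCat.{u} R) (J : Ideal R) (i : ℕ) :
    ℕᵒᵖᵒᵖ ⥤ ModuleCat.{u} R :=
  localCohomology.diagram (localCohomology.idealPowersDiagram J) i ⋙ (evaluation _ _).obj M

theorem extPowersDiagram_map_derivedExtOfKilled (J : Ideal R) {a b : ℕᵒᵖᵒᵖ} (w : a ⟶ b)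
    (e : killedCocycles Q (n + 1) (J ^ a.unop.unop))
    (e' : killedCocycles Q (n + 1) (J ^ b.unop.unop)) (h : (e : Q.cocomplex.X (n + 1)) = e') :
    ((extPowersDiagram M J (n + 1)).map w).hom (derivedExtOfKilled Q n _ e) =
      derivedExtOfKilled Q n _ e' :=
  map_derivedExtOfKilled Q n _ rfl e e' h

theorem killedCocycles_anti {j : ℕ} {J J' : Ideal R} (h : J' ≤ J) :
    killedCocycles Q j J ≤ killedCocycles Q j J' := fun _ he =>
  ⟨fun a ha => he.1 a (h ha), he.2⟩

/-- The cocone on `extPowersDiagram` with point the cohomology of the torsion subcomplex. -/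
noncomputable def torsionCohomologyCocone (J : Ideal R) :
    Cocone (extPowersDiagram M J (n + 1)) where
  pt := ModuleCat.of R (resolutionTorsionCohomology Q J (n + 1))
  ι :=
    { app a := ModuleCat.ofHom (derivedExtToTorsionCohomology Q n J a.unop.unop)
      naturality a b w := by
        ext α
        obtain ⟨e, rfl⟩ := derivedExtOfKilled_surjective Q n (J ^ a.unop.unop) α
        have hle := killedCocycles_anti Q (j := n + 1)
          (Ideal.pow_le_pow_right (I := J) w.unop.unop.down.down)
        refine (congrArg (derivedExtToTorsionCohomology Q n J b.unop.unop)
          (extPowersDiagram_map_derivedExtOfKilled Q n J w e ⟨e.1, hle e.2⟩ rfl)).trans ?_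
        refine (derivedExtToTorsionCohomology_derivedExtOfKilled Q n J b.unop.unop _).trans ?_
        exact (derivedExtToTorsionCohomology_derivedExtOfKilled Q n J a.unop.unop e).symm }

theorem nonempty_localCohomology_equiv_resolutionTorsionCohomology (J : Ideal R) :
    Nonempty ((localCohomology J (n + 1)).obj M ≃ₗ[R]
      resolutionTorsionCohomology Q J (n + 1)) := by
  let c : Cocone (extPowersDiagram M J (n + 1)) := ((evaluation _ _).obj M).mapCocone
    (colimit.cocone (localCohomology.diagram (localCohomology.idealPowersDiagram J) (n + 1)))
  have hc : IsColimit c := isColimitOfPreserves ((evaluation _ _).obj M) (colimit.isColimit _)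
  let Φ : c.pt ⟶ (torsionCohomologyCocone Q n J).pt := hc.desc (torsionCohomologyCocone Q n J)
  have hΦ : ∀ k (e : killedCocycles Q (n + 1) (J ^ k)),
      Φ.hom ((c.ι.app (op (op k))).hom (derivedExtOfKilled Q n (J ^ k) e)) =
        killedCocyclesToTorsionCohomology Q n J k e := fun k e =>
    (congrArg (fun g => g.hom (derivedExtOfKilled Q n (J ^ k) e))
      (hc.fac (torsionCohomologyCocone Q n J) (op (op k)))).trans
      (derivedExtToTorsionCohomology_derivedExtOfKilled Q n J k e)
  refine ⟨LinearEquiv.ofBijective Φ.hom ⟨(injective_iff_map_eq_zero _).mpr fun y hy => ?_,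
    fun y => ?_⟩⟩
  · have : IsFiltered ℕᵒᵖᵒᵖ := IsFiltered.of_equivalence (opOpEquivalence ℕ).symm
    have := preservesFilteredColimitsOfSize_shrink.{0, u, 0, u} (forget (ModuleCat.{u} R))
    obtain ⟨a, α, rfl⟩ := Concrete.isColimit_exists_rep _ hc y
    obtain ⟨k, rfl⟩ : ∃ k, a = op (op k) := ⟨a.unop.unop, rfl⟩
    obtain ⟨e, rfl⟩ := derivedExtOfKilled_surjective Q n (J ^ k) α
    obtain ⟨f, ⟨m, hf⟩, hfe⟩ :=
      (killedCocyclesToTorsionCohomology_eq_zero_iff Q n J k e).mp ((hΦ k e).symm.trans hy)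
    have hle := killedCocycles_anti Q (j := n + 1)
      (Ideal.pow_le_pow_right (I := J) (Nat.le_add_right k m))
    let w : (op (op k) : ℕᵒᵖᵒᵖ) ⟶ op (op (k + m)) := (homOfLE (Nat.le_add_right k m)).op.op
    have h1 := extPowersDiagram_map_derivedExtOfKilled Q n J w e ⟨e.1, hle e.2⟩ rfl
    have h2 : derivedExtOfKilled Q n (J ^ (k + m)) ⟨e.1, hle e.2⟩ = 0 :=
      (derivedExtOfKilled_eq_zero_iff Q n _ _).mpr
        ⟨f, fun a ha => hf a (Ideal.pow_le_pow_right (Nat.le_add_left m k) ha), hfe⟩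
    have h3 := congrArg (fun g => g.hom (derivedExtOfKilled Q n (J ^ k) e)) (c.w w)
    refine h3.symm.trans ((congrArg (c.ι.app (op (op (k + m)))).hom (h1.trans h2)).trans ?_)
    exact map_zero _
  · obtain ⟨⟨z, ⟨k, hk⟩, hz⟩, rfl⟩ := Submodule.Quotient.mk_surjective _ y
    exact ⟨_, hΦ k ⟨z, hk, hz⟩⟩

end LocalCohomologyTorsion

section LocalCohomologyIterated

open CategoryTheory

/-- Local cohomology in degree the number of generators as an iterated cokernel of
localization maps. -/
theorem nonempty_localCohomology_equiv_iteratedAwayCokernel {R : Type u} [CommRing R]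
    [IsNoetherianRing R] (M : ModuleCat.{u} R) (l : List R) (hl : l ≠ []) :
    Nonempty ((localCohomology (Ideal.ofList l) l.length).obj M ≃ₗ[R]
      iteratedAwayCokernel M l) := by
  let Q := injectiveResolution M
  obtain ⟨n, hn⟩ := Nat.exists_eq_succ_of_ne_zero (List.length_pos_iff.mpr hl).ne'
  have hinj : ∀ j, Module.Injective R (Q.cocomplex.X j) := fun j =>
    (Module.injective_iff_injective_object R (Q.cocomplex.X j)).mpr (Q.injective j)
  have hd : ∀ j, LinearMap.range (Q.cocomplex.d j (j + 1)).hom =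
      LinearMap.ker (Q.cocomplex.d (j + 1) (j + 2)).hom := fun j =>
    ((Q.exact_succ j).moduleCat_range_eq_ker)
  have hι : Function.Injective (Q.ι.f 0).hom := (ModuleCat.mono_iff_injective (Q.ι.f 0)).mp
    inferInstance
  have hexact : (ShortComplex.mk (Q.ι.f 0) (Q.cocomplex.d 0 1) Q.ι_f_zero_comp_complex_d).Exact :=
    ShortComplex.exact_of_f_is_kernel _ Q.isLimitKernelFork
  let ε : M ≃ₗ[R] LinearMap.ker (Q.cocomplex.d 0 1).hom :=
    (LinearEquiv.ofInjective (Q.ι.f 0).hom hι).trans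
      (LinearEquiv.ofEq _ _ hexact.moduleCat_range_eq_ker)
  obtain ⟨e₂⟩ := nonempty_torsionCohomology_equiv_iteratedAwayCokernel
    (E := fun j => Q.cocomplex.X j) (d := fun j => (Q.cocomplex.d j (j + 1)).hom) hd M ε l
  rw [hn] at e₂ ⊢
  obtain ⟨e₁⟩ := nonempty_localCohomology_equiv_resolutionTorsionCohomology Q n (Ideal.ofList l)
  exact ⟨e₁.trans e₂⟩

end LocalCohomologyIterated

section AwayCokernelSemilinear

variable {A B : Type u} [CommRing A] [CommRing B] (φ : A →+* B)
  {N N' : Type u} [AddCommGroup N] [Module A N] [AddCommGroup N'] [Module B N']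

theorem exists_localizedModule_semilinearMap (f : N →ₛₗ[φ] N') (x : A) :
    ∃ g : LocalizedModule (Submonoid.powers x) N →ₛₗ[φ]
        LocalizedModule (Submonoid.powers (φ x)) N',
      ∀ n k, g (LocalizedModule.mk n ⟨x ^ k, k, rfl⟩) =
        LocalizedModule.mk (f n) (⟨φ x ^ k, k, rfl⟩ : Submonoid.powers (φ x)) := by
  let V := LocalizedModule (Submonoid.powers (φ x)) N'
  let _ : Module A V := Module.compHom V φ
  have hsmul : ∀ (a : A) (v : V), a • v = φ a • v := fun _ _ => rfl
  let g₀ : N →ₗ[A] V :=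
    { toFun n := LocalizedModule.mkLinearMap (Submonoid.powers (φ x)) N' (f n)
      map_add' a b := by rw [map_add, map_add]
      map_smul' a n := by rw [hsmul]; simp }
  have hunit : ∀ s : Submonoid.powers x, IsUnit (algebraMap A (Module.End A V) s) := by
    rintro ⟨_, k, rfl⟩
    have h := (Module.End.isUnit_iff _).mp (IsLocalizedModule.map_units
      (LocalizedModule.mkLinearMap (Submonoid.powers (φ x)) N')
      (⟨φ x ^ k, k, rfl⟩ : Submonoid.powers (φ x)))
    refine (Module.End.isUnit_iff _).mpr ?_
    convert h using 1
    ext v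
    exact congrArg (· • v) (map_pow φ x k)
  let g := LocalizedModule.lift (Submonoid.powers x) g₀ hunit
  refine ⟨{ toFun := g, map_add' := map_add g, map_smul' := fun a v => map_smul g a v }, ?_⟩
  intro n k
  have h1 : φ x ^ k • g (LocalizedModule.mk n ⟨x ^ k, k, rfl⟩) =
      φ x ^ k • (LocalizedModule.mk (f n) ⟨φ x ^ k, k, rfl⟩ : V) := by
    have h2 : x ^ k • (LocalizedModule.mk n ⟨x ^ k, k, rfl⟩ :
        LocalizedModule (Submonoid.powers x) N) = LocalizedModule.mk n 1 := by
      rw [LocalizedModule.smul'_mk]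
      exact LocalizedModule.mk_cancel (⟨x ^ k, k, rfl⟩ : Submonoid.powers x) n
    have h3 : φ x ^ k • (LocalizedModule.mk (f n) ⟨φ x ^ k, k, rfl⟩ : V) =
        LocalizedModule.mk (f n) 1 := by
      rw [LocalizedModule.smul'_mk]
      exact LocalizedModule.mk_cancel (⟨φ x ^ k, k, rfl⟩ : Submonoid.powers (φ x)) (f n)
    rw [h3, ← map_pow, ← hsmul, ← map_smul, h2]
    have := LocalizedModule.lift_comp (Submonoid.powers x) g₀ hunit
    exact congrArg (fun h => h n) this
  exact ((Module.End.isUnit_iff _).mp (IsLocalizedModule.map_units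
      (LocalizedModule.mkLinearMap (Submonoid.powers (φ x)) N')
      (⟨φ x ^ k, k, rfl⟩ : Submonoid.powers (φ x)))).injective h1

theorem LocalizedModule.mk_mem_smul_top (S : Submonoid A) (J : Ideal A) {n : N}
    (hn : n ∈ J • (⊤ : Submodule A N)) (s : S) :
    LocalizedModule.mk n s ∈ J • (⊤ : Submodule A (LocalizedModule S N)) := by
  refine Submodule.smul_induction_on hn (fun a ha n _ => ?_) fun m n hm hn => ?_
  · rw [← LocalizedModule.smul'_mk]
    exact Submodule.smul_mem_smul ha trivial
  · have h : LocalizedModule.mk (m + n) s = LocalizedModule.mk m s + LocalizedModule.mk n s := by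
      rw [LocalizedModule.mk_add_mk, ← smul_add]
      exact (LocalizedModule.mk_cancel_common_left s s (m + n)).symm
    rw [h]
    exact add_mem hm hn

/-- Reduction maps of modules induce reduction maps on `AwayCokernel`. -/
theorem exists_awayCokernel_semilinearMap (f : N →ₛₗ[φ] N') (x : A) (J : Ideal A)
    (hf : Function.Surjective f) (hker : ∀ n, f n = 0 → n ∈ J • (⊤ : Submodule A N)) :
    ∃ g : AwayCokernel x N →ₛₗ[φ] AwayCokernel (φ x) N', Function.Surjective g ∧
      ∀ n, g n = 0 → n ∈ J • (⊤ : Submodule A (AwayCokernel x N)) := by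
  obtain ⟨g, hg⟩ := exists_localizedModule_semilinearMap φ f x
  have hle : LinearMap.range (LocalizedModule.mkLinearMap (Submonoid.powers x) N) ≤
      (LinearMap.range (LocalizedModule.mkLinearMap (Submonoid.powers (φ x)) N')).comap g := by
    rintro _ ⟨n, rfl⟩
    refine ⟨f n, ?_⟩
    have h := hg n 0
    simp only [pow_zero] at h
    exact h.symm
  refine ⟨Submodule.mapQ _ _ g hle, ?_, ?_⟩
  · intro y
    obtain ⟨y, rfl⟩ := Submodule.Quotient.mk_surjective _ y
    induction y using LocalizedModule.induction_on with
    | _ n s =>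
    obtain ⟨_, k, rfl⟩ := s
    obtain ⟨n, rfl⟩ := hf n
    exact ⟨Submodule.Quotient.mk (LocalizedModule.mk n ⟨x ^ k, k, rfl⟩),
      congrArg Submodule.Quotient.mk (hg n k)⟩
  · intro y hy
    obtain ⟨y, rfl⟩ := Submodule.Quotient.mk_surjective _ y
    induction y using LocalizedModule.induction_on with
    | _ n s =>
    obtain ⟨_, k, rfl⟩ := s
    have h1 : g (LocalizedModule.mk n ⟨x ^ k, k, rfl⟩) ∈
      LinearMap.range (LocalizedModule.mkLinearMap (Submonoid.powers (φ x)) N') :=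
      (Submodule.Quotient.mk_eq_zero _).mp hy
    obtain ⟨m', hm'⟩ := h1
    obtain ⟨m, rfl⟩ := hf m'
    rw [hg, LocalizedModule.mkLinearMap_apply, LocalizedModule.mk_eq] at hm'
    obtain ⟨⟨_, l, rfl⟩, hl⟩ := hm'
    have h2 : f (x ^ l • (x ^ k • m - n)) = 0 := by
      simp only [Submonoid.smul_def, one_smul] at hl
      simp only [map_smulₛₗ, map_sub, map_pow, smul_sub]
      rw [sub_eq_zero]
      exact hl
    have h3 := LocalizedModule.mk_mem_smul_top (Submonoid.powers x) J (hker _ h2)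
      (⟨x ^ (l + k), l + k, rfl⟩ : Submonoid.powers x)
    have h4 : LocalizedModule.mk (x ^ l • (x ^ k • m - n))
        (⟨x ^ (l + k), l + k, rfl⟩ : Submonoid.powers x) =
        LocalizedModule.mkLinearMap (Submonoid.powers x) N m -
          LocalizedModule.mk n (⟨x ^ k, k, rfl⟩ : Submonoid.powers x) := by
      rw [LocalizedModule.mkLinearMap_apply, ← sub_eq_zero, sub_sub_eq_add_sub, sub_eq_zero,
        LocalizedModule.mk_add_mk, LocalizedModule.mk_eq]
      refine ⟨1, ?_⟩
      simp only [Submonoid.smul_def, Submonoid.coe_mul, one_smul, pow_add]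
      module
    rw [h4] at h3
    have h5 := Submodule.mem_map_of_mem (f := Submodule.mkQ (LinearMap.range
      (LocalizedModule.mkLinearMap (Submonoid.powers x) N))) h3
    rw [Submodule.map_smul''] at h5
    have h6 := Submodule.smul_mono le_rfl le_top h5
    rw [map_sub] at h6
    have h7 : Submodule.mkQ (LinearMap.range (LocalizedModule.mkLinearMap (Submonoid.powers x) N))
      (LocalizedModule.mkLinearMap (Submonoid.powers x) N m) = 0 :=
      (Submodule.Quotient.mk_eq_zero _).mpr ⟨m, rfl⟩
    rw [h7, zero_sub] at h6
    exact neg_mem_iff.mp h6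

theorem exists_iteratedAwayCokernel_semilinearMap (N : ModuleCat.{u} A) (N' : ModuleCat.{u} B)
    (f : N →ₛₗ[φ] N') (J : Ideal A)
    (hf : Function.Surjective f) (hker : ∀ n, f n = 0 → n ∈ J • (⊤ : Submodule A N))
    (l : List A) :
    ∃ g : iteratedAwayCokernel N l →ₛₗ[φ] iteratedAwayCokernel N' (l.map φ),
      Function.Surjective g ∧
        ∀ n, g n = 0 → n ∈ J • (⊤ : Submodule A (iteratedAwayCokernel N l)) := by
  induction l with
  | nil => exact ⟨f, hf, hker⟩
  | cons x l ih =>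
    obtain ⟨g, hg, hgk⟩ := ih
    exact exists_awayCokernel_semilinearMap φ g x J hg hgk

end AwayCokernelSemilinear

section InjectiveHull

variable {R : Type u} [CommRing R]

theorem Module.Injective.torsionBySet (p : Ideal R) (E : Type u) [AddCommGroup E] [Module R E]
    (hE : Module.Injective R E) : Module.Injective (R ⧸ p) (Submodule.torsionBySet R E p) where
  out X Y _ _ _ _ f hf g := by
    let _ : Module R X := Module.compHom X (Ideal.Quotient.mk p)
    let _ : Module R Y := Module.compHom Y (Ideal.Quotient.mk p)
    let f' : X →ₗ[R] Y :=
      { toFun := f, map_add' := map_add f, map_smul' := fun a x => map_smul f _ x }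
    let g' : X →ₗ[R] E :=
      { toFun := fun x => g x
        map_add' := fun x y => by rw [map_add]; rfl
        map_smul' := fun a x => congrArg Subtype.val (map_smul g (Ideal.Quotient.mk p a) x) }
    obtain ⟨h, hh⟩ := hE.out f' hf g'
    have hmem : ∀ y, h y ∈ Submodule.torsionBySet R E p := fun y => by
      rw [Submodule.mem_torsionBySet_iff]
      rintro ⟨a, ha⟩
      have h1 : a • y = 0 := by
        change Ideal.Quotient.mk p a • y = 0
        rw [Ideal.Quotient.eq_zero_iff_mem.mpr ha, zero_smul]
      rw [← map_smul, h1, map_zero]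
    refine ⟨{ toFun := fun y => ⟨h y, hmem y⟩, map_add' := fun y z => Subtype.ext (map_add h y z),
              map_smul' := fun b y => ?_ }, fun x => Subtype.ext (hh x)⟩
    obtain ⟨b, rfl⟩ := Ideal.Quotient.mk_surjective b
    exact Subtype.ext (map_smul h b y)

variable [IsLocalRing R] {E : Type u} [AddCommGroup E] [Module R E]

theorem IsInjectiveHullOfResidueField.torsionBySet (p : Ideal R) [IsLocalRing (R ⧸ p)]
    (hE : IsInjectiveHullOfResidueField R E) :
    IsInjectiveHullOfResidueField (R ⧸ p) (Submodule.torsionBySet R E p) := by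
  obtain ⟨hinj, f, hf, hess⟩ := hE
  refine ⟨hinj.torsionBySet p, ?_⟩
  have hle : p ≤ maximalIdeal R := le_maximalIdeal fun h =>
    (Ideal.Quotient.zero_ne_one_iff.mp (zero_ne_one (α := R ⧸ p))) h
  have hsmul : ∀ r : R, r • f 1 = f (residue R r) := fun r => by
    rw [← map_smul, Algebra.smul_def, mul_one]; rfl
  have hzero : ∀ r : R, r • f 1 = 0 ↔ r ∈ maximalIdeal R := fun r => by
    rw [hsmul, map_eq_zero_iff f hf, residue_eq_zero_iff]
  let e : Submodule.torsionBySet R E p :=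
    ⟨f 1, (Submodule.mem_torsionBySet_iff _ _).mpr fun a => (hzero _).mpr (hle a.2)⟩
  have hker : maximalIdeal (R ⧸ p) = LinearMap.ker (LinearMap.toSpanSingleton (R ⧸ p) _ e) := by
    ext b
    obtain ⟨b, rfl⟩ := Ideal.Quotient.mk_surjective b
    have : IsLocalHom (Ideal.Quotient.mk p) :=
      IsLocalHom.of_surjective (Ideal.Quotient.mk p) Ideal.Quotient.mk_surjective
    have h1 : Ideal.Quotient.mk p b ∈ maximalIdeal (R ⧸ p) ↔ b ∈ maximalIdeal R := by
      rw [mem_maximalIdeal, mem_maximalIdeal, mem_nonunits_iff, mem_nonunits_iff, isUnit_map_iff]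
    rw [h1, ← hzero, LinearMap.mem_ker]
    exact ⟨fun h => Subtype.ext h, fun h => congrArg Subtype.val h⟩
  let g : ResidueField (R ⧸ p) →ₗ[R ⧸ p] Submodule.torsionBySet R E p :=
    (maximalIdeal (R ⧸ p)).liftQ (LinearMap.toSpanSingleton (R ⧸ p) _ e) hker.le
  refine ⟨g, LinearMap.ker_eq_bot.mp (Submodule.ker_liftQ_eq_bot _ _ _ hker.ge), ?_⟩
  intro N hN
  obtain ⟨n, hn, hn0⟩ := Submodule.exists_mem_ne_zero_of_ne_bot hN
  obtain ⟨y, ⟨hy, c, rfl⟩, hy0⟩ := Submodule.exists_mem_ne_zero_of_ne_bot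
    (hess (Submodule.span R {(n : E)}) fun h =>
      hn0 (Subtype.ext (Submodule.span_singleton_eq_bot.mp h)))
  obtain ⟨r, hr⟩ := Submodule.mem_span_singleton.mp hy
  obtain ⟨s, rfl⟩ := residue_surjective c
  refine (Submodule.ne_bot_iff _).mpr ⟨Ideal.Quotient.mk p r • n, ⟨N.smul_mem _ hn,
    residue (R ⧸ p) (Ideal.Quotient.mk p s), ?_⟩, fun h => ?_⟩
  · exact Subtype.ext ((hsmul s).trans hr.symm)
  · exact hy0 (hr.symm.trans (congrArg Subtype.val h))

theorem IsInjectiveHullOfResidueField.nontrivial_linearMap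
    (hE : IsInjectiveHullOfResidueField R E) (M : Type u) [AddCommGroup M] [Module R M]
    [Nontrivial M] : Nontrivial (M →ₗ[R] E) := by
  obtain ⟨hinj, f, hf, -⟩ := hE
  obtain ⟨m, hm⟩ := exists_ne (0 : M)
  let t := LinearMap.toSpanSingleton R M m
  have hker : LinearMap.ker t ≤ LinearMap.ker (f.comp (Algebra.linearMap R (ResidueField R))) := by
    intro r hr
    have h1 : r ∈ maximalIdeal R := le_maximalIdeal (fun h => hm (by
      have : (1 : R) ∈ LinearMap.ker t := h ▸ trivial
      simpa [t] using this)) hr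
    exact (congrArg f ((residue_eq_zero_iff r).mpr h1)).trans (map_zero f)
  obtain ⟨h, hh⟩ := hinj.out ((LinearMap.ker t).liftQ t le_rfl)
    (LinearMap.ker_eq_bot.mp (Submodule.ker_liftQ_eq_bot _ _ _ le_rfl))
    ((LinearMap.ker t).liftQ _ hker)
  refine ⟨h, 0, fun h0 => one_ne_zero (α := ResidueField R) (hf ?_)⟩
  have h1 := hh (Submodule.Quotient.mk 1)
  rw [h0] at h1
  have h2 : f (algebraMap R (ResidueField R) 1) = 0 := h1.symm
  rw [map_zero, ← h2, map_one (algebraMap R (ResidueField R))]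

end InjectiveHull

section Dual

theorem mem_associatedPrimes_linearMap_iff {R : Type u} [CommRing R] [IsNoetherianRing R]
    {M E : Type u} [AddCommGroup M] [Module R M] [AddCommGroup E] [Module R E] {p : Ideal R} :
    p ∈ associatedPrimes R (M →ₗ[R] E) ↔
      p.IsPrime ∧ ∃ f : M →ₗ[R] E, ∀ a, a ∈ p ↔ a • f = 0 := by
  rw [AssociatedPrimes.mem_iff, isAssociatedPrime_iff]
  simp only [SetLike.ext_iff, Submodule.mem_colon_singleton, Submodule.mem_bot]

variable {R : Type u} [CommRing R] (l : List R)

theorem exists_iteratedAwayCokernel_linearMap {N N' : ModuleCat.{u} R} (f : N →ₗ[R] N')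
    (J : Ideal R) (hf : Function.Surjective f)
    (hker : ∀ n, f n = 0 → n ∈ J • (⊤ : Submodule R N)) :
    ∃ g : iteratedAwayCokernel N l →ₗ[R] iteratedAwayCokernel N' l,
      Function.Surjective g ∧
        ∀ n, g n = 0 → n ∈ J • (⊤ : Submodule R (iteratedAwayCokernel N l)) := by
  have h := exists_iteratedAwayCokernel_semilinearMap (RingHom.id R) N N' f J hf hker l
  rwa [RingHom.coe_id, List.map_id] at h

theorem nontrivial_iteratedAwayCokernel_quotient_of_le {p q : Ideal R} (h : p ≤ q)
    (hq : Nontrivial (iteratedAwayCokernel (ModuleCat.of R (R ⧸ q)) l)) :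
    Nontrivial (iteratedAwayCokernel (ModuleCat.of R (R ⧸ p)) l) := by
  obtain ⟨g, hg, -⟩ := exists_iteratedAwayCokernel_linearMap l (N := ModuleCat.of R (R ⧸ p))
    (N' := ModuleCat.of R (R ⧸ q)) (Submodule.factor h) ⊤ (Submodule.factor_surjective h)
    fun n _ => by rw [Submodule.top_smul]; trivial
  exact hg.nontrivial

theorem nontrivial_iteratedAwayCokernel_of_mem_associatedPrimes [IsNoetherianRing R] {E : Type u}
    [AddCommGroup E] [Module R E] {p : Ideal R}
    (hp : p ∈ associatedPrimes R (iteratedAwayCokernel (ModuleCat.of R R) l →ₗ[R] E)) :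
    Nontrivial (iteratedAwayCokernel (ModuleCat.of R (R ⧸ p)) l) := by
  obtain ⟨hprime, f, hf⟩ := mem_associatedPrimes_linearMap_iff.mp hp
  by_contra hsub
  rw [not_nontrivial_iff_subsingleton] at hsub
  obtain ⟨g, -, hgk⟩ := exists_iteratedAwayCokernel_linearMap l (N := ModuleCat.of R R)
    (N' := ModuleCat.of R (R ⧸ p)) p.mkQ p (Submodule.mkQ_surjective p) fun n hn => by
      have h1 : n ∈ p := (Submodule.Quotient.mk_eq_zero p).mp hn
      simpa using Submodule.smul_mem_smul h1 (Submodule.mem_top (x := (1 : R)))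
  refine hprime.ne_top ((Ideal.eq_top_iff_one p).mpr ((hf 1).mpr ?_))
  rw [one_smul]
  ext z
  refine Submodule.smul_induction_on (hgk z (Subsingleton.elim _ _)) (fun a ha n _ => ?_)
    fun m n hm hn => ?_
  · rw [map_smul]
    exact congrArg (fun h => h n) ((hf a).mp ha)
  · rw [map_add, hm, hn, map_add]

theorem nontrivial_iteratedAwayCokernel_map_mk {p : Ideal R}
    (h : Nontrivial (iteratedAwayCokernel (ModuleCat.of R (R ⧸ p)) l)) :
    Nontrivial (iteratedAwayCokernel (ModuleCat.of (R ⧸ p) (R ⧸ p))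
      (l.map (Ideal.Quotient.mk p))) := by
  let f : R ⧸ p →ₛₗ[Ideal.Quotient.mk p] R ⧸ p :=
    { toFun := id, map_add' := fun _ _ => rfl, map_smul' := fun a b => Algebra.smul_def a b }
  obtain ⟨g, -, hgk⟩ := exists_iteratedAwayCokernel_semilinearMap (Ideal.Quotient.mk p)
    (ModuleCat.of R (R ⧸ p)) (ModuleCat.of (R ⧸ p) (R ⧸ p)) f ⊥ Function.surjective_id
    (fun n hn => by
      have h1 : n = 0 := hn
      rw [h1]
      exact zero_mem _) l
  simp only [Submodule.bot_smul, Submodule.mem_bot] at hgk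
  exact ((injective_iff_map_eq_zero g).mpr hgk).nontrivial

theorem mem_associatedPrimes_iteratedAwayCokernel_of_quotient [IsNoetherianRing R] {E : Type u}
    [AddCommGroup E] [Module R E] {p : Ideal R} (hp : p.IsPrime)
    (h : (⊥ : Ideal (R ⧸ p)) ∈ associatedPrimes (R ⧸ p)
      (iteratedAwayCokernel (ModuleCat.of (R ⧸ p) (R ⧸ p)) (l.map (Ideal.Quotient.mk p))
        →ₗ[R ⧸ p] Submodule.torsionBySet R E p)) :
    p ∈ associatedPrimes R (iteratedAwayCokernel (ModuleCat.of R R) l →ₗ[R] E) := by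
  obtain ⟨-, f, hf⟩ := mem_associatedPrimes_linearMap_iff.mp h
  let r : R →ₛₗ[Ideal.Quotient.mk p] R ⧸ p :=
    { toFun := Ideal.Quotient.mk p, map_add' := map_add _, map_smul' := map_mul _ }
  obtain ⟨g, hg, -⟩ := exists_iteratedAwayCokernel_semilinearMap (Ideal.Quotient.mk p)
    (ModuleCat.of R R) (ModuleCat.of (R ⧸ p) (R ⧸ p)) r ⊤ Ideal.Quotient.mk_surjective
    (fun n _ => by rw [Submodule.top_smul]; trivial) l
  let F : iteratedAwayCokernel (ModuleCat.of R R) l →ₗ[R] E :=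
    { toFun := fun z => f (g z)
      map_add' := fun y z => by rw [map_add, map_add]; rfl
      map_smul' := fun a z => by rw [map_smulₛₗ, map_smul]; rfl }
  refine mem_associatedPrimes_linearMap_iff.mpr ⟨hp, F, fun a => ?_⟩
  rw [← Ideal.Quotient.eq_zero_iff_mem, ← Ideal.mem_bot, hf]
  constructor
  · intro h
    ext z
    exact congrArg Subtype.val (congrArg (fun f => f (g z)) h)
  · intro h
    ext w
    obtain ⟨z, rfl⟩ := hg w
    exact congrArg (fun f => f z) h

end Dual

section LocalCohomologyModule

variable {R : Type u} [CommRing R] [IsNoetherianRing R] {i : ℕ} (hi : 1 ≤ i) (x : Fin i → R)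

include hi

theorem nonempty_localCohomologyModule_equiv (M : Type u) [AddCommGroup M] [Module R M] :
    Nonempty (LocalCohomologyModule (Ideal.span (Set.range x)) i M ≃ₗ[R]
      iteratedAwayCokernel (ModuleCat.of R M) (List.ofFn x)) := by
  have h1 : Ideal.span (Set.range x) = Ideal.ofList (List.ofFn x) := by
    refine congrArg Ideal.span (Set.ext fun r => ?_)
    simp [List.mem_ofFn]
  have h2 : List.ofFn x ≠ [] := by
    rw [← List.length_pos_iff, List.length_ofFn]
    exact hi
  have h3 := nonempty_localCohomology_equiv_iteratedAwayCokernel (ModuleCat.of R M) _ h2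
  rw [← h1] at h3
  rwa [List.length_ofFn] at h3

theorem nontrivial_localCohomologyModule_iff (M : Type u) [AddCommGroup M] [Module R M] :
    Nontrivial (LocalCohomologyModule (Ideal.span (Set.range x)) i M) ↔
      Nontrivial (iteratedAwayCokernel (ModuleCat.of R M) (List.ofFn x)) :=
  let ⟨e⟩ := nonempty_localCohomologyModule_equiv hi x M
  e.toEquiv.nontrivial_congr

theorem associatedPrimes_dual_localCohomologyModule (E : Type u) [AddCommGroup E] [Module R E] :
    associatedPrimes R (LocalCohomologyModule (Ideal.span (Set.range x)) i R →ₗ[R] E) =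
      associatedPrimes R (iteratedAwayCokernel (ModuleCat.of R R) (List.ofFn x) →ₗ[R] E) :=
  let ⟨e⟩ := nonempty_localCohomologyModule_equiv hi x R
  LinearEquiv.AssociatedPrimes.eq (e.congrLeft E R)

end LocalCohomologyModule

theorem ConjectureStar.opennessProperty (h : ConjectureStar.{u}) : OpennessProperty.{u} := by
  intro R _ _ _ i hi x E _ _ hE p q hp hq hpq hmem
  rw [h R i hi x E hE] at hmem ⊢
  refine ⟨hp, ?_⟩
  rw [nontrivial_localCohomologyModule_iff hi]
  exact nontrivial_iteratedAwayCokernel_quotient_of_le _ hpq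
    ((nontrivial_localCohomologyModule_iff hi x _).mp hmem.2)

theorem OpennessProperty.zeroIdealAssociatedForDomains (h : OpennessProperty.{u}) :
    ZeroIdealAssociatedForDomains.{u} := by
  intro R _ _ _ _ i hi x E _ _ hE hnt
  have := hE.nontrivial_linearMap (LocalCohomologyModule (Ideal.span (Set.range x)) i R)
  obtain ⟨q, hq⟩ := associatedPrimes.nonempty R
    (LocalCohomologyModule (Ideal.span (Set.range x)) i R →ₗ[R] E)
  exact h R i hi x E hE ⊥ q Ideal.isPrime_bot hq.1 bot_le hq

theorem ZeroIdealAssociatedForDomains.conjectureStar (h : ZeroIdealAssociatedForDomains.{u}) :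
    ConjectureStar.{u} := by
  intro R _ _ _ i hi x E _ _ hE
  rw [associatedPrimes_dual_localCohomologyModule hi]
  ext p
  simp only [Set.mem_ofPred_eq, nontrivial_localCohomologyModule_iff hi]
  refine ⟨fun hp => ⟨hp.1, nontrivial_iteratedAwayCokernel_of_mem_associatedPrimes _ hp⟩, ?_⟩
  rintro ⟨hp, hnt⟩
  have : IsLocalRing (R ⧸ p) :=
    IsLocalRing.of_surjective' (Ideal.Quotient.mk p) Ideal.Quotient.mk_surjective
  have hnt' := nontrivial_iteratedAwayCokernel_map_mk _ hnt
  rw [List.map_ofFn] at hnt'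
  have hbot := h (R ⧸ p) i hi (Ideal.Quotient.mk p ∘ x) (Submodule.torsionBySet R E p)
    (hE.torsionBySet p) ((nontrivial_localCohomologyModule_iff hi _ _).mpr hnt')
  rw [associatedPrimes_dual_localCohomologyModule hi, ← List.map_ofFn] at hbot
  exact mem_associatedPrimes_iteratedAwayCokernel_of_quotient _ hp hbot

/-- Theorem 1.1: the conjecture (*), the "openness" property (O) and the
condition on domains are all equivalent. -/
theorem stmt3 :
    [ConjectureStar.{u}, OpennessProperty.{u}, ZeroIdealAssociatedForDomains.{u}].TFAE := by
  tfae_have 1 → 2 := ConjectureStar.opennessProperty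
  tfae_have 2 → 3 := OpennessProperty.zeroIdealAssociatedForDomains
  tfae_have 3 → 1 := ZeroIdealAssociatedForDomains.conjectureStar
  tfae_finish
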